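/- arXiv:1803.08257 — 2 statements merged into one kernel-verified Lean document; each statement's English description precedes it below -/
import Mathlib

section
/- Let P ⊆ A be an inclusion of σ-unital C*-algebras and let E : A → P be a conditional expectation of finite index in the sense of Izumi that has the Rokhlin property with Rokhlin element e ∈ A^∞. Then for every x ∈ A, the element E^∞(xe) of P^∞ lies in D(P,P^∞) = closure(P·P^∞·P). -/
open scoped BoundedContinuousFunction
open Filter Topology

/-- An element of a `*`-algebra is *positive* when it is of the form `star y * y`.
In a C⋆-algebra this describes exactly the usual cone of positive elements. -/
def IsPositiveElem {B : Type*} [Mul B] [Star B] (x : B) : Prop := ∃ y, x = star y * y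

/-- A C⋆-algebra is *σ-unital* when it contains a strictly positive element, i.e. a positive
element `h` such that `h·B` is dense. -/
def IsSigmaUnital (B : Type*) [NonUnitalCStarAlgebra B] : Prop :=
  ∃ h : B, IsPositiveElem h ∧ closure {z : B | ∃ x : B, z = h * x} = Set.univ

/-- A C⋆-algebra is *simple* when it is nonzero and has no closed two-sided ideals besides
`⊥` and `⊤`. -/
def IsSimpleCStarAlgebra (B : Type*) [NonUnitalNonAssocRing B] [TopologicalSpace B] : Prop :=
  (∃ b : B, b ≠ 0) ∧ ∀ I : TwoSidedIdeal B, IsClosed (I : Set B) → I = ⊥ ∨ I = ⊤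

section SeqAlgebra

variable {A : Type*} [NonUnitalCStarAlgebra A] {Ainf : Type*} [NonUnitalCStarAlgebra Ainf]

/-- `π : ℓ∞(ℕ, A) → Ainf` presents `Ainf` as the sequence algebra
`A^∞ = ℓ∞(ℕ,A)/c₀(ℕ,A)`: it is a surjective `*`-homomorphism whose kernel is exactly
`c₀(ℕ,A)`, the ideal of sequences tending to `0` in norm. -/
def IsSequenceAlgebra (π : (ℕ →ᵇ A) →⋆ₙₐ[ℂ] Ainf) : Prop :=
  Function.Surjective π ∧ ∀ f : ℕ →ᵇ A, π f = 0 ↔ Tendsto (fun n => f n) atTop (𝓝 0)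

/-- The canonical embedding `A → A^∞` by classes of constant sequences. -/
noncomputable def seqConst (π : (ℕ →ᵇ A) →⋆ₙₐ[ℂ] Ainf) (a : A) : Ainf :=
  π (BoundedContinuousFunction.const ℕ a)

/-- `D(A, A^∞)`, the norm-closed linear span of `A·A^∞·A` inside `A^∞`. -/
def seqD (π : (ℕ →ᵇ A) →⋆ₙₐ[ℂ] Ainf) : Set Ainf :=
  closure (Submodule.span ℂ
    {z : Ainf | ∃ (a b : A) (x : Ainf), z = seqConst π a * x * seqConst π b} : Set Ainf)

/-- The copy `S^∞ ⊆ A^∞` of the sequence algebra of a subset `S ⊆ A`: classes of bounded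
sequences taking values in `S`. -/
def seqSub (π : (ℕ →ᵇ A) →⋆ₙₐ[ℂ] Ainf) (S : Set A) : Set Ainf :=
  {x : Ainf | ∃ f : ℕ →ᵇ A, (∀ n, f n ∈ S) ∧ π f = x}

end SeqAlgebra

section CondExp

variable {A : Type*} [NonUnitalCStarAlgebra A] {P : Type*} [NonUnitalCStarAlgebra P]
  {Ainf : Type*} [NonUnitalCStarAlgebra Ainf]

/-- `E : A → P` is a conditional expectation for the inclusion `incl : P ↪ A`: a positive
contractive linear map which restricts to the identity on `P` and is a `P`-bimodule map. -/
def IsCondExp (incl : P →⋆ₙₐ[ℂ] A) (E : A →ₗ[ℂ] P) : Prop :=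
  (∀ p : P, E (incl p) = p) ∧
  (∀ (p q : P) (x : A), E (incl p * x * incl q) = p * E x * q) ∧
  (∀ x : A, IsPositiveElem x → IsPositiveElem (E x)) ∧
  (∀ x : A, ‖E x‖ ≤ ‖x‖)

/-- `E` has finite index in the sense of Izumi: `(1/λ)·E - Id` is a positive map
for some `λ > 0`. -/
def IsFiniteIndex (incl : P →⋆ₙₐ[ℂ] A) (E : A →ₗ[ℂ] P) : Prop :=
  ∃ l : ℝ, 0 < l ∧ ∀ x : A, IsPositiveElem x → IsPositiveElem (l⁻¹ • incl (E x) - x)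

/-- `Einf : A^∞ → A^∞` is the coordinatewise extension of the conditional expectation `E`. -/
def IsInducedCondExp (π : (ℕ →ᵇ A) →⋆ₙₐ[ℂ] Ainf) (incl : P →⋆ₙₐ[ℂ] A) (E : A →ₗ[ℂ] P)
    (Einf : Ainf → Ainf) : Prop :=
  ∀ f g : ℕ →ᵇ A, (∀ n, g n = incl (E (f n))) → Einf (π f) = π g

/-- `e` is a Rokhlin element for the conditional expectation `E`, where the scalar `c`
plays the role of the Izumi–Watatani index `Index_w E = Ê**(1)` (a positive scalar when `A`
is simple and the index is finite).  The requirements are that `e` is a positive contraction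
in the relative commutant `A' ∩ A^∞` such that:
(i) the class `[e]` of `e` in `N(D(A,A^∞),A^∞)/Ann(D(A,A^∞),A^∞)` is a projection
    (equivalently, `e*e - e` annihilates `D(A,A^∞)`, as `e` is already positive);
(ii) `(Index_w E)·[E^∞(e)] = 1`, i.e. `c • Einf e` acts as the identity on `D(A,A^∞)`
    modulo the annihilator;
(iii) the map `A ∋ x ↦ [x·e]` is injective. -/
def IsRokhlinElement (π : (ℕ →ᵇ A) →⋆ₙₐ[ℂ] Ainf) (Einf : Ainf → Ainf) (c : ℝ) (e : Ainf) :
    Prop :=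
  IsPositiveElem e ∧ ‖e‖ ≤ 1 ∧
  (∀ a : A, e * seqConst π a = seqConst π a * e) ∧
  (∀ d ∈ seqD π, (e * e - e) * d = 0 ∧ d * (e * e - e) = 0) ∧
  (∀ d ∈ seqD π, (c • Einf e) * d = d ∧ d * (c • Einf e) = d) ∧
  (∀ x y : A, (∀ d ∈ seqD π,
      (seqConst π x * e - seqConst π y * e) * d = 0 ∧
      d * (seqConst π x * e - seqConst π y * e) = 0) → x = y)

/-- The Rokhlin property for a conditional expectation of finite index: there is a Rokhlin
element for it, where the scalar is the Izumi–Watatani index of `E`. -/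
def HasRokhlinProperty (π : (ℕ →ᵇ A) →⋆ₙₐ[ℂ] Ainf) (Einf : Ainf → Ainf) : Prop :=
  ∃ c : ℝ, 0 < c ∧ ∃ e : Ainf, IsRokhlinElement π Einf c e

end CondExp

theorem IsPositiveElem.norm_le_of_sub {B : Type*} [NonUnitalCStarAlgebra B] {x y : B}
    (hx : IsPositiveElem x) (hxy : IsPositiveElem (y - x)) : ‖x‖ ≤ ‖y‖ := by
  let _ := CStarAlgebra.spectralOrder B
  have := CStarAlgebra.spectralOrderedRing B
  obtain ⟨a, rfl⟩ := hx
  obtain ⟨b, hb⟩ := hxy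
  refine CStarAlgebra.norm_le_norm_of_nonneg_of_le (star_mul_self_nonneg a) ?_
  rw [← sub_nonneg, hb]
  exact star_mul_self_nonneg b

/-- An element of a C⋆-algebra `B` with `p * b * r = 0` for all `p` and `r` in `B` vanishes. -/
theorem eq_zero_of_forall_mul_mul_eq_zero {B : Type*} [NonUnitalCStarAlgebra B] {b : B}
    (h : ∀ p r : B, p * b * r = 0) : b = 0 := by
  have h₁ : star (star b * b) * (star b * b) = 0 := by
    simpa [mul_assoc] using h (star b) (star b * b)
  exact CStarRing.star_mul_self_eq_zero_iff b |>.1 (CStarRing.star_mul_self_eq_zero_iff _ |>.1 h₁)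

theorem exists_isSelfAdjoint_norm_sub_mul_lt {B : Type*} [NonUnitalCStarAlgebra B] (b c : B)
    {ε : ℝ} (hε : 0 < ε) :
    ∃ u : B, IsSelfAdjoint u ∧ ‖u‖ ≤ 1 ∧ ‖b - u * b‖ < ε ∧ ‖c - u * c‖ < ε := by
  let _ := CStarAlgebra.spectralOrder B
  have := CStarAlgebra.spectralOrderedRing B
  have hu := CStarAlgebra.increasingApproximateUnit B
  have key : ∀ b : B, ∀ᶠ u in CStarAlgebra.approximateUnit B, ‖b - u * b‖ < ε := fun b => by
    filter_upwards [Metric.tendsto_nhds.1 (hu.tendsto_mul_right b) ε hε] with u h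
    rwa [dist_comm, dist_eq_norm] at h
  obtain ⟨u, h₁, h₂, h₃, h₄⟩ := (hu.eventually_isSelfAdjoint.and
    (hu.eventually_norm.and ((key b).and (key c)))).exists
  exact ⟨u, h₁, h₂, h₃, h₄⟩

section CondExp

variable {A : Type*} [NonUnitalCStarAlgebra A] {P : Type*} [NonUnitalCStarAlgebra P]
  {incl : P →⋆ₙₐ[ℂ] A} {E : A →ₗ[ℂ] P}

theorem IsCondExp.map_mul_incl (hE : IsCondExp incl E) (x : A) (q : P) :
    E (x * incl q) = E x * q := by
  rw [← sub_eq_zero]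
  refine eq_zero_of_forall_mul_mul_eq_zero fun p r => ?_
  have h := hE.2.1 p (q * r) x
  have h' := hE.2.1 p r (x * incl q)
  simp only [map_mul, mul_assoc] at h h'
  simp only [mul_sub, sub_mul, mul_assoc, ← h, ← h', sub_self]

theorem IsCondExp.map_incl_mul (hE : IsCondExp incl E) (p : P) (x : A) :
    E (incl p * x) = p * E x := by
  rw [← sub_eq_zero]
  refine eq_zero_of_forall_mul_mul_eq_zero fun q r => ?_
  have h := hE.2.1 (q * p) r x
  have h' := hE.2.1 q r (incl p * x)
  simp only [map_mul, mul_assoc] at h h'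
  simp only [mul_sub, sub_mul, mul_assoc, ← h, ← h', sub_self]

theorem IsCondExp.map_star_mul_sub_mul_incl (hE : IsCondExp incl E) (x : A) {u : P}
    (hu : IsSelfAdjoint u) :
    E (star (x - x * incl u) * (x - x * incl u)) =
      (E (star x * x) - u * E (star x * x)) - (E (star x * x) - u * E (star x * x)) * u := by
  have h : star (x - x * incl u) * (x - x * incl u) =
      star x * x - incl u * (star x * x) - (star x * x) * incl u
        + incl u * (star x * x) * incl u := by
    simp only [star_sub, star_mul, ← map_star, hu.star_eq, sub_mul, mul_sub, mul_assoc]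
    abel
  rw [h, map_add, map_sub, map_sub, hE.2.1, hE.map_mul_incl, hE.map_incl_mul]
  noncomm_ring

/-- If `E : A → P` has finite index, then `P` acts nondegenerately on `A`. -/
theorem IsCondExp.exists_norm_sub_incl_mul_mul_incl_lt (hE : IsCondExp incl E)
    (hfin : IsFiniteIndex incl E) (x : A) {ε : ℝ} (hε : 0 < ε) :
    ∃ u : P, ‖x - incl u * x * incl u‖ < ε := by
  obtain ⟨l, hl, hpos⟩ := hfin
  have hδ : 0 < l * (ε / 2) ^ 2 / 2 := by positivity
  obtain ⟨u, hsa, hu, h₁, h₂⟩ := exists_isSelfAdjoint_norm_sub_mul_lt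
    (E (star x * x)) (E (star (star x) * star x)) hδ
  have key : ∀ y : A, ‖E (star y * y) - u * E (star y * y)‖ < l * (ε / 2) ^ 2 / 2 →
      ‖y - y * incl u‖ < ε / 2 := fun y hy => by
    have hp : IsPositiveElem (star (y - y * incl u) * (y - y * incl u)) := ⟨_, rfl⟩
    have hle := hp.norm_le_of_sub (hpos _ hp)
    have hincl := NonUnitalStarAlgHom.norm_apply_le incl
      (E (star (y - y * incl u) * (y - y * incl u)))
    rw [norm_smul, CStarRing.norm_star_mul_self, Real.norm_of_nonneg (inv_nonneg.2 hl.le)] at hle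
    rw [hE.map_star_mul_sub_mul_incl y hsa] at hle hincl
    set b := E (star y * y) - u * E (star y * y)
    have hb : ‖b - b * u‖ ≤ 2 * ‖b‖ := by
      have hbu := norm_mul_le b u
      have hbu' := mul_le_mul_of_nonneg_left hu (norm_nonneg b)
      linarith [norm_sub_le b (b * u)]
    have hlt : l⁻¹ * ‖incl (b - b * u)‖ < (ε / 2) ^ 2 := by
      rw [inv_mul_lt_iff₀ hl]
      linarith
    refine lt_of_pow_lt_pow_left₀ 2 (by positivity) ?_
    rw [sq]
    exact hle.trans_lt hlt
  have hr := key x h₁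
  have hl' : ‖x - incl u * x‖ < ε / 2 := by
    have h := key (star x) h₂
    rw [← norm_star] at h
    simpa [← map_star, hsa.star_eq] using h
  refine ⟨u, ?_⟩
  have hsplit : x - incl u * x * incl u = (x - incl u * x) + incl u * (x - x * incl u) := by
    noncomm_ring
  have hmul : ‖incl u * (x - x * incl u)‖ ≤ ‖x - x * incl u‖ :=
    (norm_mul_le _ _).trans (mul_le_of_le_one_left (norm_nonneg _)
      ((NonUnitalStarAlgHom.norm_apply_le incl u).trans hu))
  rw [hsplit]
  linarith [norm_add_le (x - incl u * x) (incl u * (x - x * incl u))]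

theorem IsCondExp.norm_incl_apply_le (hE : IsCondExp incl E) (x : A) : ‖incl (E x)‖ ≤ ‖x‖ :=
  (NonUnitalStarAlgHom.norm_apply_le incl (E x)).trans (hE.2.2.2 x)

/-- The coordinatewise application of a conditional expectation to a bounded sequence. -/
noncomputable def IsCondExp.mapSeq (hE : IsCondExp incl E) (f : ℕ →ᵇ A) : ℕ →ᵇ A :=
  BoundedContinuousFunction.ofNormedAddCommGroupDiscrete (fun n => incl (E (f n))) ‖f‖
    fun n => (hE.norm_incl_apply_le (f n)).trans (f.norm_coe_le_norm n)

theorem IsCondExp.mapSeq_apply (hE : IsCondExp incl E) (f : ℕ →ᵇ A) (n : ℕ) :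
    hE.mapSeq f n = incl (E (f n)) := rfl

theorem IsCondExp.norm_mapSeq_le (hE : IsCondExp incl E) (f : ℕ →ᵇ A) :
    ‖hE.mapSeq f‖ ≤ ‖f‖ :=
  BoundedContinuousFunction.norm_le (norm_nonneg f) |>.2 fun n =>
    (hE.norm_incl_apply_le (f n)).trans (f.norm_coe_le_norm n)

end CondExp

theorem condExp_rokhlin_mem_hereditary {P A Ainf : Type*} [NonUnitalCStarAlgebra P] [NonUnitalCStarAlgebra A]
    [NonUnitalCStarAlgebra Ainf]
    -- `P ⊆ A` is an inclusion of σ-unital C⋆-algebras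
    (hPσ : IsSigmaUnital P) (hAσ : IsSigmaUnital A)
    (incl : P →⋆ₙₐ[ℂ] A) (hincl : Function.Injective incl)
    -- `E` is a conditional expectation from `A` onto `P`
    (E : A →ₗ[ℂ] P) (hE : IsCondExp incl E)
    -- `E` has finite index in the sense of Izumi
    (hfin : IsFiniteIndex incl E)
    -- `Ainf` is the sequence algebra `A^∞` and `Einf` the induced conditional expectation
    (π : (ℕ →ᵇ A) →⋆ₙₐ[ℂ] Ainf) (hπ : IsSequenceAlgebra π)
    (Einf : Ainf → Ainf) (hEinf : IsInducedCondExp π incl E Einf)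
    -- `E` has the Rokhlin property with Rokhlin element `e` (the scalar `c` is the
    -- Izumi–Watatani index of `E`)
    (c : ℝ) (hc : 0 < c) (e : Ainf) (he : IsRokhlinElement π Einf c e)
    :
    -- for every `x ∈ A`, `E^∞(x·e)` lies in `D(P,P^∞) = closure (P·P^∞·P)`
    ∀ x : A, Einf (seqConst π x * e) ∈
      closure (Submodule.span ℂ
        {z : Ainf | ∃ (p q : P) (w : Ainf), w ∈ seqSub π (Set.range incl) ∧
          z = seqConst π (incl p) * w * seqConst π (incl q)} : Set Ainf) := by
  intro x
  obtain ⟨f, rfl⟩ := hπ.1 e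
  have hcomm := he.2.2.1
  let k : A → (ℕ →ᵇ A) := BoundedContinuousFunction.const ℕ
  have hEinf' : ∀ f, Einf (π f) = π (hE.mapSeq f) := fun f => hEinf f _ fun _ => rfl
  rw [Metric.mem_closure_iff]
  intro ε hε
  have hf : 0 < ‖f‖ + 1 := by positivity
  obtain ⟨u, hu⟩ := hE.exists_norm_sub_incl_mul_mul_incl_lt hfin x (div_pos hε hf)
  let a := incl u
  refine ⟨seqConst π a * π (hE.mapSeq (k x * f)) * seqConst π a,
    Submodule.subset_span ⟨u, u, _, ⟨_, fun n => ⟨_, rfl⟩, rfl⟩, rfl⟩, ?_⟩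
  have hlift : π (k (x - a * x * a) * f) = π (k x * f - k a * (k x * f) * k a) := by
    have hk : k (x - a * x * a) = k x - k a * k x * k a := by ext n; rfl
    have ha : π f * π (k a) = π (k a) * π f := hcomm a
    rw [hk]
    simp only [map_sub, map_mul, sub_mul, mul_assoc, ha]
  have hmap : hE.mapSeq (k x * f - k a * (k x * f) * k a) =
      hE.mapSeq (k x * f) - k a * hE.mapSeq (k x * f) * k a := by
    ext n
    change incl (E (x * f n - incl u * (x * f n) * incl u)) =
      incl (E (x * f n)) - incl u * incl (E (x * f n)) * incl u
    rw [map_sub, hE.2.1, map_sub, map_mul incl, map_mul incl]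
  have hdiff : Einf (seqConst π x * π f) -
      seqConst π a * π (hE.mapSeq (k x * f)) * seqConst π a =
      π (hE.mapSeq (k (x - a * x * a) * f)) := by
    rw [← hEinf' (k (x - a * x * a) * f), hlift, hEinf' (k x * f - _), hmap, map_sub, map_mul,
      map_mul, ← hEinf' (k x * f), map_mul]
    rfl
  rw [dist_eq_norm, hdiff]
  calc ‖π (hE.mapSeq (k (x - a * x * a) * f))‖
      ≤ ‖k (x - a * x * a) * f‖ :=
        (NonUnitalStarAlgHom.norm_apply_le π _).trans (hE.norm_mapSeq_le _)
    _ ≤ ‖x - a * x * a‖ * ‖f‖ := (norm_mul_le _ _).trans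
        (mul_le_mul_of_nonneg_right (BoundedContinuousFunction.norm_const_le _) (norm_nonneg f))
    _ ≤ ‖x - a * x * a‖ * (‖f‖ + 1) := by gcongr; linarith
    _ < ε := (lt_div_iff₀ hf).1 hu
end

section
/- Let A be a σ-unital simple C*-algebra and let α : G → Aut(A) be an action of a finite group G with the Rokhlin property in the sense of Nawata. Then the fixed point algebra A^α is simple, and the crossed product A ⋊_α G is simple. -/
open scoped BoundedContinuousFunction
open Filter Topology

section Action

variable {G : Type*} [Group G] [Fintype G] {A : Type*} [NonUnitalCStarAlgebra A]
  {Ainf : Type*} [NonUnitalCStarAlgebra Ainf]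

/-- `αinf` is the coordinatewise extension to the sequence algebra `A^∞` of the action `α`. -/
def IsInducedAction (π : (ℕ →ᵇ A) →⋆ₙₐ[ℂ] Ainf) (α : G → A ≃⋆ₐ[ℂ] A)
    (αinf : G → Ainf → Ainf) : Prop :=
  ∀ (g : G) (f h : ℕ →ᵇ A), (∀ n, h n = α g (f n)) → αinf g (π f) = π h

/-- Nawata's Rokhlin property for an action `α` of a finite group `G` on a σ-unital
C⋆-algebra `A`: there is a partition of unity `{e_g}` consisting of projections in
`(A' ∩ A^∞)/Ann(A,A^∞)` with `α_g(e_h) = e_{gh}`.  Here `e : G → A^∞` is a lift of the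
family of projections; all identities defining projections, the partition of unity and the
equivariance hold modulo `Ann(A,A^∞)`, i.e. after multiplying by (constant sequences from)
`A` on either side. -/
def NawataRokhlin (π : (ℕ →ᵇ A) →⋆ₙₐ[ℂ] Ainf) (α : G → A ≃⋆ₐ[ℂ] A)
    (αinf : G → Ainf → Ainf) : Prop :=
  ∃ e : G → Ainf,
    (∀ g : G, ∀ a : A, e g * seqConst π a = seqConst π a * e g) ∧
    (∀ g : G, ∀ a : A, (star (e g) - e g) * seqConst π a = 0 ∧
        seqConst π a * (star (e g) - e g) = 0) ∧
    (∀ g : G, ∀ a : A, (e g * e g - e g) * seqConst π a = 0 ∧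
        seqConst π a * (e g * e g - e g) = 0) ∧
    (∀ a : A, (∑ g : G, e g) * seqConst π a = seqConst π a ∧
        seqConst π a * (∑ g : G, e g) = seqConst π a) ∧
    (∀ g h : G, ∀ a : A, (αinf g (e h) - e (g * h)) * seqConst π a = 0 ∧
        seqConst π a * (αinf g (e h) - e (g * h)) = 0)

end Action

section CrossedProduct

variable {G : Type*} [Group G] [Fintype G] {A : Type*} [NonUnitalCStarAlgebra A]

/-- The fixed point algebra `A^α` of an action `α` of `G` on `A`. -/
def fixedPointAlgebra (α : G → A ≃⋆ₐ[ℂ] A) : NonUnitalStarSubalgebra ℂ A where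
  carrier := {a : A | ∀ g : G, α g a = a}
  add_mem' := by intro a b ha hb g; rw [map_add, ha g, hb g]
  zero_mem' := by intro g; exact map_zero (α g)
  mul_mem' := by intro a b ha hb g; rw [map_mul, ha g, hb g]
  smul_mem' := by intro c a ha g; rw [map_smul, ha g]
  star_mem' := by intro a ha g; rw [map_star, ha g]

/-- The twisted convolution product on `G → A`, the multiplication of the crossed product
`A ⋊_α G` (for finite `G` the algebraic crossed product is already complete, and its
C⋆-norm topology is the product topology of `G → A`). -/
def convMul (α : G → A ≃⋆ₐ[ℂ] A) (f h : G → A) : G → A :=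
  fun g => ∑ k : G, f k * α k (h (k⁻¹ * g))

end CrossedProduct

section Orthogonality

open CStarAlgebra in
/-- In a C⋆-algebra, a finite sum of elements `star y * y` vanishes only if every `y` does. -/
theorem eq_zero_of_sum_star_mul_self_eq_zero {B ι : Type*} [NonUnitalCStarAlgebra B]
    (s : Finset ι) (y : ι → B) (h : ∑ i ∈ s, star (y i) * y i = 0) : ∀ i ∈ s, y i = 0 := by
  let _ : PartialOrder B := spectralOrder B
  have _ : StarOrderedRing B := spectralOrderedRing B
  intro i hi
  exact CStarRing.star_mul_self_eq_zero_iff _ |>.1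
    ((Finset.sum_eq_zero_iff_of_nonneg fun j _ => star_mul_self_nonneg (y j)).1 h i hi)

/-- Elements that are projections summing to one relative to a commuting self-adjoint set `S`
are mutually orthogonal relative to `S`. -/
theorem mul_mul_eq_zero_of_relative_partition {B ι : Type*} [NonUnitalCStarAlgebra B]
    [Fintype ι] (S : Set B) (hS : ∀ c ∈ S, star c ∈ S) (e : ι → B)
    (hcomm : ∀ i, ∀ c ∈ S, e i * c = c * e i)
    (hstar : ∀ i, ∀ c ∈ S, c * star (e i) = c * e i)
    (hidem : ∀ i, ∀ c ∈ S, e i * e i * c = e i * c)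
    (hsum : ∀ c ∈ S, (∑ i, e i) * c = c) {i j : ι} (hij : j ≠ i) {c : B} (hc : c ∈ S) :
    e j * e i * c = 0 := by
  classical
  have hd := hS c hc
  have key (k : ι) : star (e k * (e i * c)) * (e k * (e i * c)) =
      star c * e i * (e k * c) * e i := by
    have h1 : star (e k * (e i * c)) = star c * e i * e k := by
      rw [star_mul, star_mul, hstar i _ hd, ← hcomm i _ hd, mul_assoc, hstar k _ hd, mul_assoc]
    rw [h1, hcomm i c hc, ← mul_assoc (e k), mul_assoc _ (e k), ← mul_assoc (e k),
      ← mul_assoc (e k), hidem k c hc]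
    simp only [mul_assoc]
  have htot : ∑ k, star (e k * (e i * c)) * (e k * (e i * c)) = star c * e i * c * e i := by
    simp only [key]
    rw [← Finset.sum_mul, ← Finset.mul_sum, ← Finset.sum_mul, hsum c hc]
  have hself : star (e i * (e i * c)) * (e i * (e i * c)) = star c * e i * c * e i := by
    have h2 : e i * (e i * c) = e i * c := by rw [← mul_assoc, hidem i c hc]
    rw [key, mul_assoc (star c), h2, ← mul_assoc (star c)]
  rw [← Finset.add_sum_erase _ _ (Finset.mem_univ i), hself, add_eq_left] at htot
  rw [mul_assoc]
  exact eq_zero_of_sum_star_mul_self_eq_zero _ _ htot j (by simpa using hij)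

end Orthogonality

/-- An element of a C⋆-algebra that is annihilated by two-sided multiplications vanishes. -/
theorem eq_zero_of_forall_mul_mul_eq_zero_s19 {A : Type*} [NonUnitalCStarAlgebra A] {x : A}
    (h : ∀ a b : A, a * x * b = 0) : x = 0 := by
  have h1 : star (star x * x) * (star x * x) = 0 := by
    rw [star_mul, star_star, ← mul_assoc, h, zero_mul]
  exact (CStarRing.star_mul_self_eq_zero_iff _).1 ((CStarRing.star_mul_self_eq_zero_iff _).1 h1)

/-- In a σ-unital C⋆-algebra, a closed set containing all products is everything. -/
theorem IsSigmaUnital.mem_of_forall_mul_mem {A : Type*} [NonUnitalCStarAlgebra A]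
    (hA : IsSigmaUnital A) {S : Set A} (hS : IsClosed S) (h : ∀ a b : A, a * b ∈ S) (x : A) :
    x ∈ S := by
  obtain ⟨u, -, hu⟩ := hA
  have : closure {z : A | ∃ x : A, z = u * x} ⊆ S :=
    closure_minimal (by rintro _ ⟨y, rfl⟩; exact h u y) hS
  exact this (hu ▸ Set.mem_univ x)

section CrossedAct

variable {G : Type*} [Fintype G] {A : Type*} [NonUnitalCStarAlgebra A] (α : G → A ≃⋆ₐ[ℂ] A)

/-- The canonical action of the crossed product on `A`. -/
def crossedAct (f : G → A) (s : A) : A := ∑ k : G, f k * α k s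

theorem crossedAct_sub (f h : G → A) (s : A) :
    crossedAct α (f - h) s = crossedAct α f s - crossedAct α h s := by
  simp [crossedAct, sub_mul, Finset.sum_sub_distrib]

theorem continuous_crossedAct (s : A) : Continuous fun f : G → A => crossedAct α f s :=
  continuous_finsetSum _ fun k _ => (continuous_apply k).mul continuous_const

theorem crossedAct_single [DecidableEq G] (k : G) (a s : A) :
    crossedAct α (Pi.single k a) s = a * α k s := by
  rw [crossedAct, Finset.sum_eq_single k]
  · simp
  · intro j _ hj
    rw [Pi.single_eq_of_ne hj, zero_mul]
  · simp

end CrossedAct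

section ConvMul

variable {G : Type*} [Group G] [Fintype G] {A : Type*} [NonUnitalCStarAlgebra A]
  (α : G → A ≃⋆ₐ[ℂ] A)

theorem convMul_single [DecidableEq G] (f : G → A) (k : G) (c : A) (g : G) :
    convMul α f (Pi.single k c) g = f (g * k⁻¹) * α (g * k⁻¹) c := by
  rw [convMul, Finset.sum_eq_single (g * k⁻¹)]
  · simp
  · intro j _ hj
    rw [Pi.single_eq_of_ne, map_zero, mul_zero]
    rintro rfl
    exact hj (by simp)
  · simp

theorem single_convMul [DecidableEq G] (f : G → A) (k : G) (c : A) (g : G) :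
    convMul α (Pi.single k c) f g = c * α k (f (k⁻¹ * g)) := by
  rw [convMul, Finset.sum_eq_single k]
  · simp
  · intro j _ hj
    rw [Pi.single_eq_of_ne hj, zero_mul]
  · simp

theorem crossedAct_convMul (hαmul : ∀ (g h : G) (x : A), α (g * h) x = α g (α h x))
    (f h : G → A) (s : A) :
    crossedAct α (convMul α f h) s = crossedAct α f (crossedAct α h s) := by
  simp only [crossedAct, convMul, Finset.sum_mul, map_sum, Finset.mul_sum, map_mul]
  rw [Finset.sum_comm]
  refine Finset.sum_congr rfl fun k _ => ?_
  rw [← Equiv.sum_comp (Equiv.mulLeft k)]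
  refine Finset.sum_congr rfl fun g _ => ?_
  simp [hαmul, mul_assoc]

theorem continuous_starAlgEquiv (φ : A ≃⋆ₐ[ℂ] A) : Continuous φ :=
  (StarAlgEquiv.isometry φ).continuous

/-- The sum over the orbit, as a map into the fixed point algebra. -/
def orbitSum (hαmul : ∀ (g h : G) (x : A), α (g * h) x = α g (α h x)) (a : A) :
    fixedPointAlgebra α :=
  ⟨∑ k : G, α k a, fun g => by
    rw [map_sum, ← Equiv.sum_comp (Equiv.mulLeft g) fun k => α k a]
    exact Finset.sum_congr rfl fun k _ => (hαmul g k a).symm⟩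

variable (hαmul : ∀ (g h : G) (x : A), α (g * h) x = α g (α h x))

theorem continuous_orbitSum : Continuous (orbitSum α hαmul) :=
  Continuous.subtype_mk (continuous_finsetSum _ fun k _ => continuous_starAlgEquiv (α k)) _

theorem orbitSum_add (a b : A) :
    orbitSum α hαmul (a + b) = orbitSum α hαmul a + orbitSum α hαmul b :=
  Subtype.ext (by simp [orbitSum, Finset.sum_add_distrib])

theorem orbitSum_zero : orbitSum α hαmul 0 = 0 :=
  Subtype.ext (by simp [orbitSum])

theorem orbitSum_sub (a b : A) :
    orbitSum α hαmul (a - b) = orbitSum α hαmul a - orbitSum α hαmul b :=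
  Subtype.ext (by simp [orbitSum, Finset.sum_sub_distrib])

theorem orbitSum_apply (g : G) (a : A) : orbitSum α hαmul (α g a) = orbitSum α hαmul a :=
  Subtype.ext (by
    simp only [orbitSum, ← hαmul]
    exact Equiv.sum_comp (Equiv.mulRight g) fun k => α k a)

theorem orbitSum_sum {ι : Type*} (s : Finset ι) (f : ι → A) :
    orbitSum α hαmul (∑ i ∈ s, f i) = ∑ i ∈ s, orbitSum α hαmul (f i) :=
  map_sum (AddMonoidHom.mk' (orbitSum α hαmul) (orbitSum_add α hαmul)) f s

theorem orbitSum_mul_coe (a : A) (x : fixedPointAlgebra α) :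
    orbitSum α hαmul (a * x) = orbitSum α hαmul a * x := by
  refine Subtype.ext ?_
  change ∑ k, α k (a * x) = (∑ k, α k a) * x
  rw [Finset.sum_mul]
  exact Finset.sum_congr rfl fun k _ => by rw [map_mul, x.2 k]

theorem orbitSum_coe (x : fixedPointAlgebra α) :
    orbitSum α hαmul (x : A) = (Fintype.card G : ℂ) • x := by
  refine Subtype.ext ?_
  change ∑ k, α k (x : A) = (Fintype.card G : ℂ) • (x : A)
  rw [Finset.sum_congr rfl fun k _ => x.2 k]
  simp [Nat.cast_smul_eq_nsmul]

theorem orbitSum_surjective : Function.Surjective (orbitSum α hαmul) := by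
  intro x
  have hG : (Fintype.card G : ℂ) ≠ 0 := Nat.cast_ne_zero.2 Fintype.card_ne_zero
  refine ⟨(((Fintype.card G : ℂ)⁻¹ • x : fixedPointAlgebra α) : A), ?_⟩
  rw [orbitSum_coe, smul_inv_smul₀ hG]

theorem crossedAct_const (a s : A) :
    crossedAct α (fun _ => a) s = a * orbitSum α hαmul s := by
  rw [crossedAct, ← Finset.mul_sum]; rfl

/-- The ideal of the crossed product induced by an ideal of the fixed point algebra. -/
def inducedIdeal (I : TwoSidedIdeal (fixedPointAlgebra α)) : Set (G → A) :=
  {f | ∀ a s : A, orbitSum α hαmul (a * crossedAct α f s) ∈ I}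

theorem isClosed_inducedIdeal {I : TwoSidedIdeal (fixedPointAlgebra α)}
    (hI : IsClosed (I : Set (fixedPointAlgebra α))) : IsClosed (inducedIdeal α hαmul I) := by
  simp only [inducedIdeal, Set.ofPred_forall]
  refine isClosed_iInter fun a => isClosed_iInter fun s => hI.preimage ?_
  exact (continuous_orbitSum α hαmul).comp
    (continuous_const.mul (continuous_crossedAct α s))

theorem zero_mem_inducedIdeal (I : TwoSidedIdeal (fixedPointAlgebra α)) :
    0 ∈ inducedIdeal α hαmul I := fun a s => by
  simp [crossedAct, orbitSum_zero, I.zero_mem]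

theorem sub_mem_inducedIdeal {I : TwoSidedIdeal (fixedPointAlgebra α)} {f h : G → A}
    (hf : f ∈ inducedIdeal α hαmul I) (hh : h ∈ inducedIdeal α hαmul I) :
    f - h ∈ inducedIdeal α hαmul I := fun a s => by
  rw [crossedAct_sub, mul_sub, orbitSum_sub]
  exact I.sub_mem (hf a s) (hh a s)

theorem convMul_mem_inducedIdeal_right {I : TwoSidedIdeal (fixedPointAlgebra α)} {f : G → A}
    (hf : f ∈ inducedIdeal α hαmul I) (h : G → A) :
    convMul α f h ∈ inducedIdeal α hαmul I := fun a s => by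
  rw [crossedAct_convMul α hαmul]
  exact hf _ _

theorem convMul_mem_inducedIdeal_left {I : TwoSidedIdeal (fixedPointAlgebra α)} {f : G → A}
    (hf : f ∈ inducedIdeal α hαmul I) (h : G → A) :
    convMul α h f ∈ inducedIdeal α hαmul I := fun a s => by
  rw [crossedAct_convMul α hαmul, crossedAct, Finset.mul_sum, orbitSum_sum]
  refine I.finsetSum_mem _ _ fun k _ => ?_
  obtain ⟨b, hb⟩ := EquivLike.surjective (α k) (a * h k)
  rw [← mul_assoc, ← hb, ← map_mul, orbitSum_apply]
  exact hf b s

theorem const_mem_inducedIdeal {I : TwoSidedIdeal (fixedPointAlgebra α)}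
    {x : fixedPointAlgebra α} (hx : x ∈ I) :
    (fun _ => (x : A)) ∈ inducedIdeal α hαmul I := fun a s => by
  rw [crossedAct_const α hαmul, ← mul_assoc, orbitSum_mul_coe, orbitSum_mul_coe]
  exact I.mul_mem_right _ _ (I.mul_mem_left _ _ hx)

theorem eq_top_of_inducedIdeal_eq_univ (hA : IsSigmaUnital A) (hα1 : ∀ x : A, α 1 x = x)
    {I : TwoSidedIdeal (fixedPointAlgebra α)} (hI : IsClosed (I : Set (fixedPointAlgebra α)))
    (h : inducedIdeal α hαmul I = Set.univ) : I = ⊤ := by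
  classical
  have hcl := hI.preimage (continuous_orbitSum α hαmul)
  have hmem (a : A) : orbitSum α hαmul a ∈ I := by
    refine hA.mem_of_forall_mul_mem hcl (fun a b => ?_) a
    refine hA.mem_of_forall_mul_mem
      (hcl.preimage (f := fun b => a * b) (continuous_const.mul continuous_id)) (fun b s => ?_) b
    have hb : (Pi.single 1 b : G → A) ∈ inducedIdeal α hαmul I := h ▸ Set.mem_univ _
    have := hb a s
    rwa [crossedAct_single, hα1] at this
  refine TwoSidedIdeal.ext fun x => ⟨fun _ => trivial, fun _ => ?_⟩
  obtain ⟨a, rfl⟩ := orbitSum_surjective α hαmul x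
  exact hmem a

theorem exists_fixedPointAlgebra_ne_zero
    (hαmul : ∀ (g h : G) (x : A), α (g * h) x = α g (α h x)) (hα1 : ∀ x : A, α 1 x = x)
    (h : ∃ a : A, a ≠ 0) :
    ∃ x : fixedPointAlgebra α, x ≠ 0 := by
  obtain ⟨a, ha⟩ := h
  refine ⟨orbitSum α hαmul (star a * a), fun h0 => ha ?_⟩
  have h1 : ∑ k, star (α k a) * α k a = 0 := by
    simp only [← map_star, ← map_mul]
    exact congrArg Subtype.val h0
  simpa [hα1] using
    eq_zero_of_sum_star_mul_self_eq_zero Finset.univ (fun k => α k a) h1 1 (Finset.mem_univ _)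

end ConvMul

section Rokhlin

variable {G : Type*} [Group G] [Fintype G] {A Ainf : Type*} [NonUnitalCStarAlgebra A]
  [NonUnitalCStarAlgebra Ainf]

theorem seqConst_mul (π : (ℕ →ᵇ A) →⋆ₙₐ[ℂ] Ainf) (a b : A) :
    seqConst π (a * b) = seqConst π a * seqConst π b := by
  rw [seqConst, seqConst, seqConst, ← map_mul]; rfl

theorem star_seqConst (π : (ℕ →ᵇ A) →⋆ₙₐ[ℂ] Ainf) (a : A) :
    star (seqConst π a) = seqConst π (star a) := by
  rw [seqConst, seqConst, ← map_star]; rfl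

theorem IsSequenceAlgebra.tendsto_of_apply_eq_seqConst {π : (ℕ →ᵇ A) →⋆ₙₐ[ℂ] Ainf}
    (hπ : IsSequenceAlgebra π) {f : ℕ →ᵇ A} {a : A} (h : π f = seqConst π a) :
    Tendsto (fun n => f n) atTop (𝓝 a) := by
  have := (hπ.2 (f - BoundedContinuousFunction.const ℕ a)).1 (by rw [map_sub, h]; exact sub_self _)
  simpa using this.add_const a

/-- Lifting Rokhlin projections to sequences in `A`: compression by them picks out the
coefficient at the identity. -/
theorem NawataRokhlin.exists_tendsto [DecidableEq G] {α : G → A ≃⋆ₐ[ℂ] A}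
    {π : (ℕ →ᵇ A) →⋆ₙₐ[ℂ] Ainf} (hπ : IsSequenceAlgebra π) {αinf : G → Ainf → Ainf}
    (hαinf : IsInducedAction π α αinf) (h : NawataRokhlin π α αinf) :
    ∃ E : G → ℕ → A, ∀ (k : G) (c : A),
      Tendsto (fun n => ∑ g, E g n * c * α k (E g n)) atTop (𝓝 (if k = 1 then c else 0)) := by
  obtain ⟨e, hcomm, hstar, hidem, hsum, hequiv⟩ := h
  choose E hE using fun g => hπ.1 (e g)
  refine ⟨fun g n => E g n, fun k c => ?_⟩
  let F (g : G) : ℕ →ᵇ A := BoundedContinuousFunction.ofNormedAddCommGroupDiscrete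
    (fun n => α k (E g n)) ‖E g‖ fun n => by
      rw [StarAlgEquiv.norm_map]; exact (E g).norm_coe_le_norm n
  have hF (g : G) : π (F g) = αinf k (e g) := by
    rw [← hE g]; exact (hαinf k (E g) (F g) fun _ => rfl).symm
  have horth {g j : G} (hgj : g ≠ j) : e g * e j * seqConst π c = 0 := by
    refine mul_mul_eq_zero_of_relative_partition (Set.range (seqConst π)) ?_ e ?_ ?_ ?_ ?_ hgj
      ⟨c, rfl⟩
    · rintro _ ⟨a, rfl⟩; exact ⟨star a, (star_seqConst π a).symm⟩
    · rintro i _ ⟨a, rfl⟩; exact hcomm i a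
    · rintro i _ ⟨a, rfl⟩; exact sub_eq_zero.1 (by rw [← mul_sub]; exact (hstar i a).2)
    · rintro i _ ⟨a, rfl⟩; exact sub_eq_zero.1 (by rw [← sub_mul]; exact (hidem i a).1)
    · rintro _ ⟨a, rfl⟩; exact (hsum a).1
  have hterm (g : G) : π (E g * BoundedContinuousFunction.const ℕ c * F g) =
      e g * e (k * g) * seqConst π c := by
    have h1 : seqConst π c * αinf k (e g) = seqConst π c * e (k * g) :=
      sub_eq_zero.1 (by rw [← mul_sub]; exact (hequiv k g c).2)
    rw [map_mul, map_mul, hE, hF]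
    change e g * seqConst π c * _ = _
    rw [mul_assoc, h1, ← hcomm, mul_assoc]
  have hlim := hπ.tendsto_of_apply_eq_seqConst
    (f := ∑ g, E g * BoundedContinuousFunction.const ℕ c * F g) (a := if k = 1 then c else 0) <| by
      simp only [map_sum, hterm]
      split_ifs with hk
      · subst hk
        have h2 (g : G) : e g * e (1 * g) * seqConst π c = e g * seqConst π c := by
          rw [one_mul]; exact sub_eq_zero.1 (by rw [← sub_mul]; exact (hidem g c).1)
        simp only [h2]
        rw [← Finset.sum_mul, (hsum c).1]
      · rw [Finset.sum_eq_zero fun g _ => horth fun hg => hk (mul_eq_right.1 hg.symm)]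
        exact (map_zero π).symm
  simpa [F] using hlim

end Rokhlin

section CrossedProductSimple

variable {G : Type*} [Group G] [Fintype G] {A : Type*} [NonUnitalCStarAlgebra A]
  {α : G → A ≃⋆ₐ[ℂ] A}

theorem single_one_convMul_single [DecidableEq G] (hα1 : ∀ x : A, α 1 x = x) (a b : A) (k : G) :
    convMul α (Pi.single 1 a) (Pi.single k b) = Pi.single k (a * b) := by
  ext g
  rw [single_convMul, hα1, inv_one, one_mul]
  by_cases h : g = k
  · subst h; simp
  · simp [h]

/-- The intersection with the coefficient algebra `A` of a two-sided ideal of the crossed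
product. -/
def coeffIdeal [DecidableEq G] (hα1 : ∀ x : A, α 1 x = x) (I : Set (G → A))
    (hzero : (0 : G → A) ∈ I) (hsub : ∀ x ∈ I, ∀ y ∈ I, x - y ∈ I)
    (hmul : ∀ x ∈ I, ∀ h : G → A, convMul α x h ∈ I ∧ convMul α h x ∈ I) : TwoSidedIdeal A :=
  have hneg {x : A} (hx : (Pi.single 1 x : G → A) ∈ I) : (Pi.single 1 (-x) : G → A) ∈ I := by
    simpa [Pi.single_neg] using hsub _ hzero _ hx
  TwoSidedIdeal.mk' {a | (Pi.single 1 a : G → A) ∈ I} (by simpa using hzero)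
    (fun {x y} hx hy => by
      simpa [Pi.single_neg, Pi.single_add] using hsub _ hx _ (hneg hy))
    (fun {_} hx => hneg hx)
    (fun {x y} hy => by simpa [single_one_convMul_single hα1] using (hmul _ hy (Pi.single 1 x)).2)
    (fun {x y} hx => by simpa [single_one_convMul_single hα1] using (hmul _ hx (Pi.single 1 y)).1)

/-- A crossed product by a finite group is simple when the coefficient at the identity can be
recovered by approximate compressions. -/
theorem crossedProduct_ideal_eq [DecidableEq G] (hAσ : IsSigmaUnital A)
    (hsimple : IsSimpleCStarAlgebra A) (hα1 : ∀ x : A, α 1 x = x) {E : G → ℕ → A}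
    (hE : ∀ (k : G) (c : A),
      Tendsto (fun n => ∑ g, E g n * c * α k (E g n)) atTop (𝓝 (if k = 1 then c else 0)))
    (I : Set (G → A)) (hclosed : IsClosed I)
    (hzero : (0 : G → A) ∈ I) (hsub : ∀ x ∈ I, ∀ y ∈ I, x - y ∈ I)
    (hmul : ∀ x ∈ I, ∀ h : G → A, convMul α x h ∈ I ∧ convMul α h x ∈ I) :
    I = {0} ∨ I = Set.univ := by
  let I' : AddSubgroup (G → A) := AddSubgroup.ofSub I ⟨0, hzero⟩ fun x hx y hy => by
    simpa [sub_eq_add_neg] using hsub x hx y hy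
  have hsum {ι : Type _} (s : Finset ι) (f : ι → G → A) (hf : ∀ i ∈ s, f i ∈ I) :
      ∑ i ∈ s, f i ∈ I := I'.sum_mem hf
  have hcoeff (x) (hx : x ∈ I) (a b : A) : (Pi.single 1 (a * x 1 * b) : G → A) ∈ I := by
    refine hclosed.mem_of_tendsto (f := fun n => ∑ g, convMul α (Pi.single 1 (E g n * a))
      (convMul α x (Pi.single 1 (b * E g n)))) (b := atTop) ?_
      (Eventually.of_forall fun n => hsum _ _ fun g _ => (hmul _ (hmul _ hx _).1 _).2)
    refine tendsto_pi_nhds.2 fun k => ?_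
    have hk := hE k (a * x k * α k b)
    have hval : (Pi.single 1 (a * x 1 * b) : G → A) k =
        if k = 1 then a * x k * α k b else 0 := by
      split_ifs with h
      · subst h; simp [hα1]
      · simp [h]
    rw [hval]
    refine hk.congr fun n => ?_
    rw [Finset.sum_apply]
    refine Finset.sum_congr rfl fun g _ => ?_
    rw [single_convMul, convMul_single, hα1]
    simp [mul_assoc]
  let J := coeffIdeal hα1 I hzero hsub hmul
  have hJ (a : A) : a ∈ J ↔ (Pi.single 1 a : G → A) ∈ I := by
    rw [show J = coeffIdeal hα1 I hzero hsub hmul from rfl, coeffIdeal, TwoSidedIdeal.mem_mk']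
    rfl
  have hJclosed : IsClosed (J : Set A) := by
    have : (J : Set A) = (fun a => (Pi.single 1 a : G → A)) ⁻¹' I := Set.ext hJ
    rw [this]
    exact hclosed.preimage (continuous_single 1)
  rcases hsimple.2 J hJclosed with h | h
  · left
    have hone (x) (hx : x ∈ I) : x 1 = 0 := eq_zero_of_forall_mul_mul_eq_zero_s19 fun a b => by
      have := (hJ _).2 (hcoeff x hx a b)
      rw [h] at this
      exact this
    refine Set.eq_singleton_iff_unique_mem.2 ⟨hzero, fun x hx => funext fun k => ?_⟩
    refine eq_zero_of_forall_mul_mul_eq_zero_s19 fun a b => ?_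
    obtain ⟨c, rfl⟩ := EquivLike.surjective (α k) b
    have := hone _ (hmul _ hx (Pi.single k⁻¹ c)).1
    rw [convMul_single, inv_inv, one_mul] at this
    rw [mul_assoc, this, mul_zero]
  · right
    refine Set.eq_univ_of_forall fun f => ?_
    rw [← Finset.univ_sum_single f]
    refine hsum _ _ fun k _ => ?_
    refine hAσ.mem_of_forall_mul_mem (S := (fun a => (Pi.single k a : G → A)) ⁻¹' I)
      (hclosed.preimage (continuous_single k)) (fun a b => ?_) (f k)
    have ha : (Pi.single 1 a : G → A) ∈ I := (hJ a).1 (h ▸ trivial)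
    rw [Set.mem_preimage, ← single_one_convMul_single hα1 a b k]
    exact (hmul _ ha (Pi.single k b)).1

end CrossedProductSimple

theorem fixedPointAlgebra_and_crossedProduct_simple_of_nawata_rokhlin
    {G : Type*} [Group G] [Fintype G]
    {A Ainf : Type*} [NonUnitalCStarAlgebra A] [NonUnitalCStarAlgebra Ainf]
    -- `A` is a σ-unital simple C⋆-algebra
    (hAσ : IsSigmaUnital A) (hsimple : IsSimpleCStarAlgebra A)
    -- `α` is an action of the finite group `G` on `A`
    (α : G → A ≃⋆ₐ[ℂ] A) (hα1 : ∀ x : A, α 1 x = x)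
    (hαmul : ∀ (g h : G) (x : A), α (g * h) x = α g (α h x))
    -- `Ainf` is the sequence algebra `A^∞`, `αinf` the coordinatewise extension of `α`
    (π : (ℕ →ᵇ A) →⋆ₙₐ[ℂ] Ainf) (hπ : IsSequenceAlgebra π)
    (αinf : G → Ainf → Ainf) (hαinf : IsInducedAction π α αinf)
    -- `α` has the Rokhlin property in the sense of Nawata
    (hNawata : NawataRokhlin π α αinf) :
    -- the fixed point algebra `A^α` is simple, and the crossed product `A ⋊_α G`
    -- (realized as `G → A` with the twisted convolution product and the product
    -- topology) is simple, i.e. has no nontrivial closed two-sided ideals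
    IsSimpleCStarAlgebra (fixedPointAlgebra α) ∧
    ((∃ f : G → A, f ≠ 0) ∧
      ∀ I : Set (G → A), IsClosed I → (0 : G → A) ∈ I →
        (∀ x ∈ I, ∀ y ∈ I, x - y ∈ I) →
        (∀ x ∈ I, ∀ h : G → A, convMul α x h ∈ I ∧ convMul α h x ∈ I) →
        I = {0} ∨ I = Set.univ) := by
  classical
  obtain ⟨E, hE⟩ := hNawata.exists_tendsto hπ hαinf
  have hcross := crossedProduct_ideal_eq hAσ hsimple hα1 hE
  obtain ⟨a, ha⟩ := hsimple.1
  refine ⟨⟨exists_fixedPointAlgebra_ne_zero α hαmul hα1 hsimple.1, fun I hI => ?_⟩,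
    ⟨fun _ => a, fun h => ha (congrFun h 1)⟩, hcross⟩
  rcases hcross (inducedIdeal α hαmul I) (isClosed_inducedIdeal α hαmul hI)
    (zero_mem_inducedIdeal α hαmul I) (fun _ hx _ hy => sub_mem_inducedIdeal α hαmul hx hy)
    (fun _ hx h => ⟨convMul_mem_inducedIdeal_right α hαmul hx h,
      convMul_mem_inducedIdeal_left α hαmul hx h⟩) with h | h
  · left
    refine TwoSidedIdeal.ext fun x => ⟨fun hx => ?_, fun hx => ?_⟩
    · have h0 : (fun _ : G => (x : A)) ∈ ({0} : Set (G → A)) :=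
        h ▸ const_mem_inducedIdeal α hαmul hx
      exact Subtype.ext (congrFun h0 1)
    · have : x = 0 := hx
      exact this ▸ I.zero_mem
  · exact Or.inr (eq_top_of_inducedIdeal_eq_univ α hαmul hAσ hα1 hI h)
end
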